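/- arXiv:2002.07430 — 5 statements merged into one kernel-verified Lean document; each statement's English description precedes it below -/
import Mathlib

section
/- Let μ, ν be real with μ > −3/2 and |μ| > |ν|. Then the function x ↦ L_μ(x)/t̃_{μ,ν}(x) is strictly increasing on (0,∞). If instead μ > −3/2 and |μ| < |ν| < μ+3, then x ↦ L_μ(x)/t̃_{μ,ν}(x) is strictly decreasing on (0,∞). -/
open Real

/-- Normalized modified Lommel function of the first kind. -/
noncomputable def modLommel (μ ν x : ℝ) : ℝ :=
  ∑' k : ℕ, (x / 2) ^ (μ + 2 * (k : ℝ) + 1) /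
    (Gamma ((k : ℝ) + (μ - ν + 3) / 2) * Gamma ((k : ℝ) + (μ + ν + 3) / 2))

/-- Modified Struve function of the first kind. -/
noncomputable def modStruve (ν x : ℝ) : ℝ :=
  ∑' k : ℕ, (x / 2) ^ (2 * (k : ℝ) + ν + 1) /
    (Gamma ((k : ℝ) + 3 / 2) * Gamma ((k : ℝ) + ν + 3 / 2))

/-- If `a k / b k` is strictly increasing, then so is `(∑ a k t ^ k) / (∑ b k t ^ k)` for `t > 0`,
stated in cross-multiplied form. -/
theorem tsum_mul_tsum_lt_of_strictMono_div {a b : ℕ → ℝ} (ha : ∀ k, 0 < a k) (hb : ∀ k, 0 < b k)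
    (hab : StrictMono fun k => a k / b k)
    (hsa : ∀ t : ℝ, 0 < t → Summable fun k => a k * t ^ k)
    (hsb : ∀ t : ℝ, 0 < t → Summable fun k => b k * t ^ k)
    {s t : ℝ} (hs : 0 < s) (hst : s < t) :
    (∑' k, a k * s ^ k) * (∑' k, b k * t ^ k) < (∑' k, a k * t ^ k) * ∑' k, b k * s ^ k := by
  have ht : 0 < t := hs.trans hst
  have product {u v : ℝ} (hu : 0 < u) (hv : 0 < v) :
      HasSum (fun z : ℕ × ℕ => (a z.1 * u ^ z.1) * (b z.2 * v ^ z.2))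
        ((∑' k, a k * u ^ k) * ∑' k, b k * v ^ k) :=
    (hsa u hu).hasSum.mul (hsb v hv).hasSum <|
      (hsa u hu).mul_of_nonneg (hsb v hv)
        (fun k => (mul_pos (ha k) (pow_pos hu k)).le) (fun k => (mul_pos (hb k) (pow_pos hv k)).le)
  have hdiff := (product ht hs).sub (product hs ht)
  have hsum := hdiff.add ((Equiv.prodComm ℕ ℕ).hasSum_iff.mpr hdiff)
  have hcross {j k : ℕ} (h : k < j) : 0 < a j * b k - a k * b j := by
    have := hab h
    rw [div_lt_div_iff₀ (hb k) (hb j)] at this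
    linarith
  have hpow {j k : ℕ} (h : k < j) : 0 < t ^ j * s ^ k - s ^ j * t ^ k := by
    obtain ⟨m, rfl⟩ := Nat.exists_eq_add_of_lt h
    have : s ^ (m + 1) < t ^ (m + 1) := pow_lt_pow_left₀ hst hs.le (by omega)
    have h2 := mul_pos (mul_pos (pow_pos hs k) (pow_pos ht k)) (sub_pos.mpr this)
    calc 0 < s ^ k * t ^ k * (t ^ (m + 1) - s ^ (m + 1)) := h2
      _ = _ := by ring
  have hpos : 0 < ∑' z : ℕ × ℕ,
      (a z.1 * b z.2 - a z.2 * b z.1) * (t ^ z.1 * s ^ z.2 - s ^ z.1 * t ^ z.2) := by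
    refine Summable.tsum_pos (hsum.summable.congr fun z => ?_) (fun z => ?_) (1, 0)
      (mul_pos (hcross one_pos) (hpow one_pos))
    · simp only [Function.comp, Equiv.prodComm_apply, Prod.fst_swap, Prod.snd_swap]
      ring
    · rcases lt_trichotomy z.1 z.2 with h | h | h
      · have := mul_pos (hcross h) (hpow h)
        nlinarith
      · simp [h]
      · exact (mul_pos (hcross h) (hpow h)).le
  have heq := hsum.tsum_eq
  rw [tsum_congr fun z => show _ =
      (a z.1 * b z.2 - a z.2 * b z.1) * (t ^ z.1 * s ^ z.2 - s ^ z.1 * t ^ z.2) by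
    simp only [Function.comp, Equiv.prodComm_apply, Prod.fst_swap, Prod.snd_swap]
    ring] at heq
  linarith

/-- The coefficients `1 / (Γ(k + p) Γ(k + q))`. -/
noncomputable def gammaCoeff (p q : ℝ) (k : ℕ) : ℝ := (Gamma (k + p) * Gamma (k + q))⁻¹

theorem gammaCoeff_pos {p q : ℝ} (hp : 0 < p) (hq : 0 < q) (k : ℕ) : 0 < gammaCoeff p q k :=
  inv_pos.mpr (mul_pos (Gamma_pos_of_pos (by positivity)) (Gamma_pos_of_pos (by positivity)))

theorem gammaCoeff_succ {p q : ℝ} (hp : 0 < p) (hq : 0 < q) (k : ℕ) :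
    gammaCoeff p q (k + 1) = gammaCoeff p q k / ((k + p) * (k + q)) := by
  have hkp : (k : ℝ) + p ≠ 0 := by positivity
  have hkq : (k : ℝ) + q ≠ 0 := by positivity
  have h {r : ℝ} : ((k + 1 : ℕ) : ℝ) + r = k + r + 1 := by push_cast; ring
  rw [gammaCoeff, gammaCoeff, h, h, Gamma_add_one hkp, Gamma_add_one hkq, div_eq_mul_inv,
    ← mul_inv]
  ring

theorem summable_gammaCoeff_mul_pow {p q : ℝ} (hp : 0 < p) (hq : 0 < q) {t : ℝ} (ht : 0 < t) :
    Summable fun k => gammaCoeff p q k * t ^ k := by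
  refine summable_of_ratio_test_tendsto_lt_one zero_lt_one
    (.of_forall fun k => (mul_pos (gammaCoeff_pos hp hq k) (pow_pos ht k)).ne') ?_
  have hlim : Filter.Tendsto (fun k : ℕ => t / (((k : ℝ) + p) * (k + q))) Filter.atTop (nhds 0) :=
    Filter.Tendsto.const_div_atTop
      ((Filter.tendsto_atTop_add_const_right _ _ tendsto_natCast_atTop_atTop).atTop_mul_atTop₀
        (Filter.tendsto_atTop_add_const_right _ _ tendsto_natCast_atTop_atTop)) t
  refine hlim.congr fun k => ?_
  have hc := gammaCoeff_pos hp hq k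
  rw [norm_of_nonneg (mul_pos (gammaCoeff_pos hp hq _) (pow_pos ht _)).le,
    norm_of_nonneg (mul_pos hc (pow_pos ht _)).le, gammaCoeff_succ hp hq]
  field_simp
  ring

theorem strictMono_gammaCoeff_div {p q p' q' : ℝ} (hp : 0 < p) (hq : 0 < q) (hp' : 0 < p')
    (hq' : 0 < q') (hadd : p + q = p' + q') (hmul : p * q < p' * q') :
    StrictMono fun k => gammaCoeff p q k / gammaCoeff p' q' k := by
  refine strictMono_nat_of_lt_succ fun k => ?_
  have hc := gammaCoeff_pos hp hq k
  have hc' := gammaCoeff_pos hp' hq' k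
  rw [gammaCoeff_succ hp hq, gammaCoeff_succ hp' hq', div_div_div_eq,
    mul_comm _ (gammaCoeff p' q' k), mul_div_mul_comm]
  refine lt_mul_of_one_lt_right (div_pos hc hc') ?_
  rw [one_lt_div (by positivity)]
  linear_combination hmul + (k : ℝ) * hadd

theorem tsum_gammaCoeff_pos {p q : ℝ} (hp : 0 < p) (hq : 0 < q) {t : ℝ} (ht : 0 < t) :
    0 < ∑' k, gammaCoeff p q k * t ^ k :=
  (summable_gammaCoeff_mul_pow hp hq ht).tsum_pos
    (fun k => (mul_pos (gammaCoeff_pos hp hq k) (pow_pos ht k)).le) 0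
    (mul_pos (gammaCoeff_pos hp hq 0) (pow_pos ht 0))

theorem rpow_add_two_mul_natCast {y : ℝ} (hy : 0 < y) (r : ℝ) (k : ℕ) :
    y ^ (r + 2 * (k : ℝ)) = y ^ r * (y ^ 2) ^ k := by
  rw [rpow_add hy, ← pow_mul, ← rpow_natCast y (2 * k)]
  push_cast
  rfl

theorem modLommel_eq (μ ν : ℝ) {x : ℝ} (hx : 0 < x) :
    modLommel μ ν x = (x / 2) ^ (μ + 1) *
      ∑' k, gammaCoeff ((μ - ν + 3) / 2) ((μ + ν + 3) / 2) k * ((x / 2) ^ 2) ^ k := by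
  rw [modLommel, ← tsum_mul_left]
  refine tsum_congr fun k => ?_
  rw [add_right_comm, rpow_add_two_mul_natCast (half_pos hx), gammaCoeff]
  ring

theorem modStruve_eq (ν : ℝ) {x : ℝ} (hx : 0 < x) :
    modStruve ν x = (x / 2) ^ (ν + 1) *
      ∑' k, gammaCoeff (3 / 2) (ν + 3 / 2) k * ((x / 2) ^ 2) ^ k := by
  rw [modStruve, ← tsum_mul_left]
  refine tsum_congr fun k => ?_
  rw [show 2 * (k : ℝ) + ν + 1 = ν + 1 + 2 * k by ring, rpow_add_two_mul_natCast (half_pos hx),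
    gammaCoeff, add_assoc (k : ℝ)]
  ring

theorem modStruve_div_modLommel (μ ν : ℝ) {x : ℝ} (hx : 0 < x) :
    modStruve μ x / modLommel μ ν x =
      (∑' k, gammaCoeff (3 / 2) (μ + 3 / 2) k * ((x / 2) ^ 2) ^ k) /
        ∑' k, gammaCoeff ((μ - ν + 3) / 2) ((μ + ν + 3) / 2) k * ((x / 2) ^ 2) ^ k := by
  rw [modStruve_eq μ hx, modLommel_eq μ ν hx,
    mul_div_mul_left _ _ (rpow_pos_of_pos (half_pos hx) _).ne']

theorem stmt_1 (μ ν : ℝ) (hμ : μ > -3/2) :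
    (|μ| > |ν| →
      StrictMonoOn (fun x : ℝ => modStruve μ x / modLommel μ ν x) (Set.Ioi (0 : ℝ))) ∧
    (|μ| < |ν| → |ν| < μ + 3 →
      StrictAntiOn (fun x : ℝ => modStruve μ x / modLommel μ ν x) (Set.Ioi (0 : ℝ))) := by
  have h3 : (0 : ℝ) < 3 / 2 := by norm_num
  have hμ' : 0 < μ + 3 / 2 := by linarith
  have hadd : (3 / 2 : ℝ) + (μ + 3 / 2) = (μ - ν + 3) / 2 + (μ + ν + 3) / 2 := by ring
  have hsq {x y : ℝ} (hx : 0 < x) (hxy : x < y) : (x / 2) ^ 2 < (y / 2) ^ 2 := by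
    gcongr
  refine ⟨fun h => ?_, fun h h' => ?_⟩
  · have hν : |ν| < μ + 3 := by
      rcases abs_cases μ with ⟨e, _⟩ | ⟨e, _⟩ <;> linarith
    obtain ⟨hl, hr⟩ := abs_lt.mp hν
    have hp : 0 < (μ - ν + 3) / 2 := by linarith
    have hq : 0 < (μ + ν + 3) / 2 := by linarith
    intro x hx y hy hxy
    rw [Set.mem_Ioi] at hx hy
    simp only [modStruve_div_modLommel μ ν hx, modStruve_div_modLommel μ ν hy]
    rw [div_lt_div_iff₀ (tsum_gammaCoeff_pos hp hq (by positivity))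
      (tsum_gammaCoeff_pos hp hq (by positivity))]
    refine tsum_mul_tsum_lt_of_strictMono_div (gammaCoeff_pos h3 hμ') (gammaCoeff_pos hp hq)
      (strictMono_gammaCoeff_div h3 hμ' hp hq hadd ?_)
      (fun _ => summable_gammaCoeff_mul_pow h3 hμ') (fun _ => summable_gammaCoeff_mul_pow hp hq)
      (by positivity) (hsq hx hxy)
    linarith [sq_lt_sq.mpr h]
  · obtain ⟨hl, hr⟩ := abs_lt.mp h'
    have hp : 0 < (μ - ν + 3) / 2 := by linarith
    have hq : 0 < (μ + ν + 3) / 2 := by linarith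
    intro x hx y hy hxy
    rw [Set.mem_Ioi] at hx hy
    simp only [modStruve_div_modLommel μ ν hx, modStruve_div_modLommel μ ν hy]
    rw [div_lt_div_iff₀ (tsum_gammaCoeff_pos hp hq (by positivity))
      (tsum_gammaCoeff_pos hp hq (by positivity)),
      mul_comm (∑' k, gammaCoeff (3 / 2) _ k * ((y / 2) ^ 2) ^ k),
      mul_comm (∑' k, gammaCoeff (3 / 2) _ k * ((x / 2) ^ 2) ^ k)]
    refine tsum_mul_tsum_lt_of_strictMono_div (gammaCoeff_pos hp hq) (gammaCoeff_pos h3 hμ')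
      (strictMono_gammaCoeff_div hp hq h3 hμ' hadd.symm ?_)
      (fun _ => summable_gammaCoeff_mul_pow hp hq) (fun _ => summable_gammaCoeff_mul_pow h3 hμ')
      (by positivity) (hsq hx hxy)
    linarith [sq_lt_sq.mpr h]
end

section
/- Fix real μ, ν with μ > −3 and |ν| < μ+3, and fix x > 0. Then the function δ ↦ t̃_{μ+δ+1,ν+δ+1}(x)/t̃_{μ+δ,ν+δ}(x) is strictly decreasing for δ ∈ (0,∞). -/
open Real

/-- For `0 < s ≤ t`, the ratio `Γ(s + m) / Γ(s)` is at most `Γ(t + m) / Γ(t)`. -/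
lemma Gamma_mul_Gamma_add_nat_le {s t : ℝ} (hs : 0 < s) (hst : s ≤ t) (m : ℕ) :
    Gamma t * Gamma (s + m) ≤ Gamma s * Gamma (t + m) := by
  have ht : 0 < t := hs.trans_le hst
  induction m with
  | zero => simp [mul_comm]
  | succ m ih =>
    have hs' : 0 < s + m := by positivity
    have ht' : 0 < t + m := by positivity
    push_cast
    rw [← add_assoc, ← add_assoc, Gamma_add_one hs'.ne', Gamma_add_one ht'.ne']
    calc Gamma t * ((s + m) * Gamma (s + m)) = (s + m) * (Gamma t * Gamma (s + m)) := by ring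
      _ ≤ (t + m) * (Gamma s * Gamma (t + m)) := by
        have := Gamma_pos_of_pos ht
        have := Gamma_pos_of_pos hs'
        gcongr
      _ = Gamma s * ((t + m) * Gamma (t + m)) := by ring

lemma Gamma_mul_Gamma_add_nat_succ_lt {s t : ℝ} (hs : 0 < s) (hst : s < t) (m : ℕ) :
    Gamma t * Gamma (s + m + 1) < Gamma s * Gamma (t + m + 1) := by
  have ht : 0 < t := hs.trans hst
  have hs' : 0 < s + m := by positivity
  have ht' : 0 < t + m := by positivity
  have h1 := Gamma_pos_of_pos ht
  have h2 := Gamma_pos_of_pos hs'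
  have h3 := Gamma_mul_Gamma_add_nat_le hs hst.le m
  rw [Gamma_add_one hs'.ne', Gamma_add_one ht'.ne']
  calc Gamma t * ((s + m) * Gamma (s + m)) = (s + m) * (Gamma t * Gamma (s + m)) := by ring
    _ < (t + m) * (Gamma t * Gamma (s + m)) := by gcongr
    _ ≤ (t + m) * (Gamma s * Gamma (t + m)) := by gcongr
    _ = Gamma s * ((t + m) * Gamma (t + m)) := by ring

lemma sum_mul_sub_by_parts (W g : ℕ → ℝ) (n : ℕ) :
    ∑ k ∈ Finset.range (n + 1), W k * (g (k + 1) - g k) =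
      W n * g (n + 1) - W 0 * g 0 - ∑ k ∈ Finset.range n, (W (k + 1) - W k) * g (k + 1) := by
  induction n with
  | zero => simp; ring
  | succ n ih => rw [Finset.sum_range_succ, ih, Finset.sum_range_succ]; ring

/-- A symmetric unimodal weight `W` gives positive weighted increments of any sequence `g` whose
reflection about the centre dominates it on the left half. -/
lemma sum_mul_sub_pos (W g : ℕ → ℝ) (n : ℕ) (hsymm : ∀ k ≤ n, W (n - k) = W k)
    (hW0 : 0 < W 0) (hW : ∀ k, 2 * k + 1 ≤ n → W k ≤ W (k + 1))
    (hg0 : g 0 < g (n + 1)) (hg : ∀ k, 2 * k + 1 ≤ n → g (k + 1) ≤ g (n - k)) :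
    0 < ∑ k ∈ Finset.range (n + 1), W k * (g (k + 1) - g k) := by
  have hreflect : ∑ k ∈ Finset.range n, (W (k + 1) - W k) * g (k + 1) =
      ∑ k ∈ Finset.range n, (W k - W (k + 1)) * g (n - k) := by
    rw [← Finset.sum_range_reflect]
    refine Finset.sum_congr rfl fun k hk => ?_
    have hk := Finset.mem_range.1 hk
    have e1 : n - 1 - k + 1 = n - k := by omega
    have e2 : n - 1 - k = n - (k + 1) := by omega
    rw [e1, e2, hsymm k (by omega), hsymm (k + 1) (by omega)]
  have hnonneg : 0 ≤ ∑ k ∈ Finset.range n, (W (k + 1) - W k) * (g (n - k) - g (k + 1)) := by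
    refine Finset.sum_nonneg fun k hk => ?_
    have hk := Finset.mem_range.1 hk
    rcases le_total (2 * k + 1) n with h | h
    · exact mul_nonneg (sub_nonneg.2 (hW k h)) (sub_nonneg.2 (hg k h))
    · have h1 := hW (n - (k + 1)) (by omega)
      have h2 := hg (n - (k + 1)) (by omega)
      have e1 : n - (k + 1) + 1 = n - k := by omega
      have e2 : n - (n - (k + 1)) = k + 1 := by omega
      rw [e1, hsymm k (by omega), hsymm (k + 1) (by omega)] at h1
      rw [e1, e2] at h2
      exact mul_nonneg_of_nonpos_of_nonpos (sub_nonpos.2 h1) (sub_nonpos.2 h2)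
  have hsplit : ∑ k ∈ Finset.range n, (W (k + 1) - W k) * (g (n - k) - g (k + 1)) =
      -∑ k ∈ Finset.range n, (W k - W (k + 1)) * g (n - k) -
        ∑ k ∈ Finset.range n, (W (k + 1) - W k) * g (k + 1) := by
    rw [← Finset.sum_neg_distrib, ← Finset.sum_sub_distrib]
    exact Finset.sum_congr rfl fun k _ => by ring
  have hWn : W n = W 0 := by simpa using hsymm 0 (Nat.zero_le n)
  have hpos := mul_pos hW0 (sub_pos.2 hg0)
  rw [sum_mul_sub_by_parts, hWn]
  linarith

/-- The general term of the power series in `z = (x / 2) ^ 2` underlying `modLommel`. -/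
noncomputable def lommelTerm (a z b : ℝ) (k : ℕ) : ℝ :=
  z ^ k / (Gamma (k + a) * Gamma (k + b))

lemma lommelTerm_pos {a z b : ℝ} (ha : 0 < a) (hz : 0 < z) (hb : 0 < b) (k : ℕ) :
    0 < lommelTerm a z b k := by
  have h1 : 0 < Gamma (k + a) := Gamma_pos_of_pos (by positivity)
  have h2 : 0 < Gamma (k + b) := Gamma_pos_of_pos (by positivity)
  unfold lommelTerm
  positivity

lemma lommelTerm_succ {a z b : ℝ} (ha : 0 < a) (hb : 0 < b) (k : ℕ) :
    lommelTerm a z b (k + 1) = z / ((k + a) * (k + b)) * lommelTerm a z b k := by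
  have ha' : 0 < (k : ℝ) + a := by positivity
  have hb' : 0 < (k : ℝ) + b := by positivity
  have h1 := Gamma_pos_of_pos ha'
  have h2 := Gamma_pos_of_pos hb'
  unfold lommelTerm
  push_cast
  rw [add_right_comm, add_right_comm (k : ℝ) 1 b, Gamma_add_one ha'.ne', Gamma_add_one hb'.ne', pow_succ']
  field_simp

lemma summable_lommelTerm {a z b : ℝ} (ha : 0 < a) (hz : 0 < z) (hb : 0 < b) :
    Summable (lommelTerm a z b) := by
  refine summable_of_ratio_test_tendsto_lt_one (l := 0) one_pos
    (.of_forall fun k => (lommelTerm_pos ha hz hb k).ne') ?_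
  have hratio : ∀ k : ℕ, ‖lommelTerm a z b (k + 1)‖ / ‖lommelTerm a z b k‖ =
      z / ((k + a) * (k + b)) := fun k => by
    have hk := lommelTerm_pos ha hz hb k
    rw [norm_of_nonneg (lommelTerm_pos ha hz hb _).le, norm_of_nonneg hk.le,
      lommelTerm_succ ha hb, mul_div_cancel_right₀ _ hk.ne']
  simp_rw [hratio]
  refine Filter.Tendsto.const_div_atTop ?_ z
  exact (Filter.tendsto_atTop_add_const_right _ a tendsto_natCast_atTop_atTop).atTop_mul_atTop₀
    (Filter.tendsto_atTop_add_const_right _ b tendsto_natCast_atTop_atTop)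

lemma sum_lommelTerm_mul_lt {a z b c : ℝ} (ha : 0 < a) (hz : 0 < z) (hb : 0 < b) (hbc : b < c)
    (n : ℕ) :
    ∑ k ∈ Finset.range (n + 1), lommelTerm a z b k * lommelTerm a z (c + 1) (n - k) <
      ∑ k ∈ Finset.range (n + 1), lommelTerm a z (b + 1) k * lommelTerm a z c (n - k) := by
  have hc : 0 < c := hb.trans hbc
  set W : ℕ → ℝ := fun k => 1 / (Gamma (k + a) * Gamma ((n - k : ℕ) + a)) with hWdef
  set g : ℕ → ℝ := fun k => 1 / (Gamma (k + b) * Gamma ((n : ℝ) - k + c + 1)) with hgdef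
  have hΓ : ∀ {s : ℝ} (k : ℕ), 0 < s → 0 < Gamma (k + s) := fun k hs =>
    Gamma_pos_of_pos (by positivity)
  have hpos : 0 < ∑ k ∈ Finset.range (n + 1), W k * (g (k + 1) - g k) := by
    refine sum_mul_sub_pos W g n ?_ ?_ ?_ ?_ ?_
    · intro k hk
      simp only [hWdef]
      rw [Nat.sub_sub_self hk, mul_comm]
    · have := hΓ 0 ha
      have := hΓ (n - 0) ha
      simp only [hWdef]
      positivity
    · intro k hk
      have h := Gamma_mul_Gamma_add_nat_le (s := k + a) (t := (n - (k + 1) : ℕ) + a)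
        (by positivity) (by gcongr; omega) 1
      have e1 : ((n - (k + 1) : ℕ) : ℝ) + a + (1 : ℕ) = (n - k : ℕ) + a := by
        rw [Nat.cast_sub (by omega), Nat.cast_sub (by omega)]; push_cast; ring
      have e2 : (k : ℝ) + a + (1 : ℕ) = (k + 1 : ℕ) + a := by push_cast; ring
      rw [e1, e2] at h
      have := hΓ (k + 1) ha
      have := hΓ (n - (k + 1)) ha
      simp only [hWdef]
      apply one_div_le_one_div_of_le (by positivity)
      linarith
    · have h := Gamma_mul_Gamma_add_nat_succ_lt hb hbc n
      have e1 : ((n + 1 : ℕ) : ℝ) + b = b + n + 1 := by push_cast; ring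
      have e2 : (n : ℝ) - (n + 1 : ℕ) + c + 1 = c := by push_cast; ring
      have e3 : (n : ℝ) - (0 : ℕ) + c + 1 = c + n + 1 := by push_cast; ring
      have e4 : ((0 : ℕ) : ℝ) + b = b := by simp
      simp only [hgdef]
      rw [e1, e2, e3, e4]
      have := Gamma_pos_of_pos hc
      have : 0 < Gamma (b + n + 1) := Gamma_pos_of_pos (by positivity)
      apply one_div_lt_one_div_of_lt (by positivity)
      linarith
    · intro k hk
      obtain ⟨m, rfl⟩ := Nat.exists_eq_add_of_le hk
      have h := Gamma_mul_Gamma_add_nat_le (s := k + 1 + b) (t := k + 1 + c)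
        (by positivity) (by gcongr) m
      have e0 : 2 * k + 1 + m - k = k + 1 + m := by omega
      have e1 : ((k + 1 + m : ℕ) : ℝ) + b = k + 1 + b + m := by push_cast; ring
      have e2 : ((2 * k + 1 + m : ℕ) : ℝ) - (k + 1 + m : ℕ) + c + 1 = k + 1 + c := by
        push_cast; ring
      have e3 : ((2 * k + 1 + m : ℕ) : ℝ) - (k + 1 : ℕ) + c + 1 = k + 1 + c + m := by
        push_cast; ring
      have e4 : ((k + 1 : ℕ) : ℝ) + b = k + 1 + b := by push_cast; ring
      simp only [hgdef]
      rw [e0, e1, e2, e3, e4]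
      have : 0 < Gamma (k + 1 + c) := Gamma_pos_of_pos (by positivity)
      have : 0 < Gamma (k + 1 + b + m) := Gamma_pos_of_pos (by positivity)
      apply one_div_le_one_div_of_le (by positivity)
      linarith
  have hdiff : ∑ k ∈ Finset.range (n + 1), lommelTerm a z (b + 1) k * lommelTerm a z c (n - k) -
      ∑ k ∈ Finset.range (n + 1), lommelTerm a z b k * lommelTerm a z (c + 1) (n - k) =
      z ^ n * ∑ k ∈ Finset.range (n + 1), W k * (g (k + 1) - g k) := by
    rw [← Finset.sum_sub_distrib, Finset.mul_sum]
    refine Finset.sum_congr rfl fun k hk => ?_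
    have hk : k ≤ n := Nat.lt_succ_iff.1 (Finset.mem_range.1 hk)
    have hz' : z ^ n = z ^ k * z ^ (n - k) := by rw [← pow_add, Nat.add_sub_cancel' hk]
    have e1 : (n : ℝ) - (k + 1 : ℕ) + c + 1 = (n - k : ℕ) + c := by
      rw [Nat.cast_sub hk]; push_cast; ring
    have e2 : (n : ℝ) - k + c + 1 = (n - k : ℕ) + (c + 1) := by
      rw [Nat.cast_sub hk]; ring
    have e3 : ((k + 1 : ℕ) : ℝ) + b = k + (b + 1) := by push_cast; ring
    simp only [hWdef, hgdef, lommelTerm]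
    rw [e1, e2, e3, hz']
    ring
  rw [← sub_pos, hdiff]
  positivity

lemma tsum_lommelTerm_mul_lt {a z b c : ℝ} (ha : 0 < a) (hz : 0 < z) (hb : 0 < b) (hbc : b < c) :
    (∑' k, lommelTerm a z b k) * ∑' k, lommelTerm a z (c + 1) k <
      (∑' k, lommelTerm a z (b + 1) k) * ∑' k, lommelTerm a z c k := by
  have hc : 0 < c := hb.trans hbc
  have hsum : ∀ {s : ℝ}, 0 < s → Summable fun k => ‖lommelTerm a z s k‖ := fun hs =>
    (summable_lommelTerm ha hz hs).norm
  have hb1 : 0 < b + 1 := by positivity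
  have hc1 : 0 < c + 1 := by positivity
  rw [tsum_mul_tsum_eq_tsum_sum_range_of_summable_norm (hsum hb) (hsum hc1),
    tsum_mul_tsum_eq_tsum_sum_range_of_summable_norm (hsum hb1) (hsum hc)]
  exact Summable.tsum_lt_tsum (i := 0) (fun n => (sum_lommelTerm_mul_lt ha hz hb hbc n).le)
    (sum_lommelTerm_mul_lt ha hz hb hbc 0)
    (summable_norm_sum_mul_range_of_summable_norm (hsum hb) (hsum hc1)).of_norm
    (summable_norm_sum_mul_range_of_summable_norm (hsum hb1) (hsum hc)).of_norm

lemma modLommel_eq_rpow_mul_tsum (μ ν : ℝ) {x : ℝ} (hx : 0 < x) :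
    modLommel μ ν x = (x / 2) ^ (μ + 1) *
      ∑' k, lommelTerm ((μ - ν + 3) / 2) ((x / 2) ^ 2) ((μ + ν + 3) / 2) k := by
  rw [modLommel, ← tsum_mul_left]
  refine tsum_congr fun k => ?_
  have hpow : (x / 2) ^ (μ + 2 * (k : ℝ) + 1) = (x / 2) ^ (μ + 1) * ((x / 2) ^ 2) ^ k := by
    rw [add_right_comm, rpow_add (by positivity), ← pow_mul, ← rpow_natCast]
    push_cast
    rfl
  rw [hpow, lommelTerm, mul_div_assoc]

theorem stmt_5 (μ ν x : ℝ) (hμ : μ > -3) (hν : |ν| < μ + 3) (hx : x > 0) :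
    StrictAntiOn (fun δ : ℝ => modLommel (μ + δ + 1) (ν + δ + 1) x / modLommel (μ + δ) (ν + δ) x)
      (Set.Ioi (0 : ℝ)) := by
  obtain ⟨hν1, hν2⟩ := abs_lt.1 hν
  set a := (μ - ν + 3) / 2 with ha_def
  set β := (μ + ν + 3) / 2 with hβ_def
  have ha : 0 < a := by linarith
  have hβ : 0 < β := by linarith
  have hz : 0 < (x / 2) ^ 2 := by positivity
  have hratio : ∀ δ : ℝ,
      modLommel (μ + δ + 1) (ν + δ + 1) x / modLommel (μ + δ) (ν + δ) x =
        x / 2 * ((∑' k, lommelTerm a ((x / 2) ^ 2) (β + δ + 1) k) /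
          ∑' k, lommelTerm a ((x / 2) ^ 2) (β + δ) k) := fun δ => by
    have e1 : (μ + δ + 1 - (ν + δ + 1) + 3) / 2 = a := by rw [ha_def]; ring
    have e2 : (μ + δ - (ν + δ) + 3) / 2 = a := by rw [ha_def]; ring
    have e3 : (μ + δ + 1 + (ν + δ + 1) + 3) / 2 = β + δ + 1 := by rw [hβ_def]; ring
    have e4 : (μ + δ + (ν + δ) + 3) / 2 = β + δ := by rw [hβ_def]; ring
    have hy : (x / 2) ^ (μ + δ + 1) ≠ 0 := (rpow_pos_of_pos (by positivity) _).ne'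
    rw [modLommel_eq_rpow_mul_tsum _ _ hx, modLommel_eq_rpow_mul_tsum _ _ hx, e1, e2, e3, e4,
      rpow_add_one (by positivity), mul_assoc, mul_div_mul_left _ _ hy, mul_div_assoc]
  intro δ hδ ε hε hlt
  have hδ : 0 < δ := hδ
  have hε : 0 < ε := hε
  have hS : ∀ {s : ℝ}, 0 < s → 0 < ∑' k, lommelTerm a ((x / 2) ^ 2) s k := fun hs =>
    (summable_lommelTerm ha hz hs).tsum_pos (fun k => (lommelTerm_pos ha hz hs k).le) 0
      (lommelTerm_pos ha hz hs 0)
  simp only [hratio]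
  refine mul_lt_mul_of_pos_left ?_ (by positivity)
  rw [div_lt_div_iff₀ (hS (by positivity)) (hS (by positivity)), mul_comm]
  exact tsum_lommelTerm_mul_lt ha hz (by positivity) (by gcongr)
end

section
/- Let μ, ν be real with −3/2 < ν < μ. Then for all x > 0, t̃_{μ,ν}(x) < (√π · 2^{ν−μ−1} Γ(ν+3/2) / (Γ((μ−ν+3)/2) Γ((μ+ν+3)/2))) · x^{μ−ν} L_ν(x). The inequality is reversed (with strict >) for all x > 0 if either (−3 < μ ≤ −3/2 and |ν| < μ+3) or (μ > −3/2 and μ < ν < μ+3). -/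
open Real

open Filter Topology

/-- The power series with coefficients `1 / (Γ(k + a) Γ(k + b))`, to which both the modified Lommel
and the modified Struve function reduce. -/
noncomputable def gammaSeries (a b y : ℝ) : ℝ :=
  ∑' k : ℕ, y ^ k / (Gamma ((k : ℝ) + a) * Gamma ((k : ℝ) + b))

lemma Gamma_natCast_succ_add {a : ℝ} (ha : 0 < a) (k : ℕ) :
    Gamma (((k + 1 : ℕ) : ℝ) + a) = ((k : ℝ) + a) * Gamma ((k : ℝ) + a) := by
  rw [← Real.Gamma_add_one (by positivity)]
  congr 1
  push_cast
  ring

lemma summable_gammaSeries {a b y : ℝ} (ha : 0 < a) (hb : 0 < b) (hy : 0 < y) :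
    Summable fun k : ℕ => y ^ k / (Gamma ((k : ℝ) + a) * Gamma ((k : ℝ) + b)) := by
  have hGa (k : ℕ) : 0 < Gamma ((k : ℝ) + a) := Gamma_pos_of_pos (by positivity)
  have hGb (k : ℕ) : 0 < Gamma ((k : ℝ) + b) := Gamma_pos_of_pos (by positivity)
  refine summable_of_ratio_test_tendsto_lt_one zero_lt_one
    (Eventually.of_forall fun k => (div_pos (pow_pos hy k) (mul_pos (hGa k) (hGb k))).ne') ?_
  have hlim : Tendsto (fun k : ℕ => y / (((k : ℝ) + a) * ((k : ℝ) + b))) atTop (𝓝 0) :=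
    ((tendsto_natCast_atTop_atTop.atTop_add tendsto_const_nhds).atTop_mul_atTop₀
      (tendsto_natCast_atTop_atTop.atTop_add tendsto_const_nhds)).const_div_atTop y
  refine hlim.congr fun k => ?_
  have hpos (j : ℕ) : 0 < y ^ j / (Gamma ((j : ℝ) + a) * Gamma ((j : ℝ) + b)) :=
    div_pos (pow_pos hy j) (mul_pos (hGa j) (hGb j))
  rw [Real.norm_of_nonneg (hpos _).le, Real.norm_of_nonneg (hpos _).le,
    Gamma_natCast_succ_add ha, Gamma_natCast_succ_add hb, pow_succ]
  have hGak := (hGa k).ne'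
  have hGbk := (hGb k).ne'
  have hak : (k : ℝ) + a ≠ 0 := by positivity
  have hbk : (k : ℝ) + b ≠ 0 := by positivity
  field_simp

lemma Gamma_mul_Gamma_shift_le {a b p q : ℝ} (ha : 0 < a) (hb : 0 < b) (hp : 0 < p) (hq : 0 < q)
    (h : ∀ j : ℕ, ((j : ℝ) + p) * (j + q) < (j + a) * (j + b)) (k : ℕ) :
    Gamma a * Gamma b * (Gamma ((k : ℝ) + p) * Gamma ((k : ℝ) + q)) ≤
      Gamma p * Gamma q * (Gamma ((k : ℝ) + a) * Gamma ((k : ℝ) + b)) := by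
  induction k with
  | zero => simp only [Nat.cast_zero, zero_add]; exact (mul_comm _ _).le
  | succ k ih =>
    rw [Gamma_natCast_succ_add ha, Gamma_natCast_succ_add hb, Gamma_natCast_succ_add hp,
      Gamma_natCast_succ_add hq]
    have hR : 0 ≤ Gamma a * Gamma b * (Gamma ((k : ℝ) + p) * Gamma ((k : ℝ) + q)) := by positivity
    have hmul := mul_le_mul (h k).le ih hR (by positivity)
    linarith

lemma gammaSeries_lt {a b p q y : ℝ} (ha : 0 < a) (hb : 0 < b) (hp : 0 < p) (hq : 0 < q)
    (hy : 0 < y) (h : ∀ j : ℕ, ((j : ℝ) + p) * (j + q) < (j + a) * (j + b)) :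
    Gamma a * Gamma b * gammaSeries a b y < Gamma p * Gamma q * gammaSeries p q y := by
  have hGa := Gamma_pos_of_pos ha
  have hGb := Gamma_pos_of_pos hb
  have hGp := Gamma_pos_of_pos hp
  have hGq := Gamma_pos_of_pos hq
  unfold gammaSeries
  rw [← tsum_mul_left, ← tsum_mul_left]
  refine Summable.tsum_lt_tsum (i := 1) (fun k => ?_) ?_
    ((summable_gammaSeries ha hb hy).mul_left _) ((summable_gammaSeries hp hq hy).mul_left _)
  · have hle := Gamma_mul_Gamma_shift_le ha hb hp hq h k
    have hka : 0 < Gamma ((k : ℝ) + a) := Gamma_pos_of_pos (by positivity)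
    have hkb : 0 < Gamma ((k : ℝ) + b) := Gamma_pos_of_pos (by positivity)
    have hkp : 0 < Gamma ((k : ℝ) + p) := Gamma_pos_of_pos (by positivity)
    have hkq : 0 < Gamma ((k : ℝ) + q) := Gamma_pos_of_pos (by positivity)
    rw [mul_div_assoc', mul_div_assoc', div_le_div_iff₀ (by positivity) (by positivity)]
    nlinarith [mul_le_mul_of_nonneg_left hle (pow_pos hy k).le]
  · have h0 := h 0
    have hS (c : ℝ) (hc : 0 < c) : Gamma (((1 : ℕ) : ℝ) + c) = c * Gamma c := by
      simpa using Gamma_natCast_succ_add hc 0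
    simp only [Nat.cast_zero, zero_add] at h0
    rw [hS a ha, hS b hb, hS p hp, hS q hq, pow_one,
      show Gamma a * Gamma b * (y / (a * Gamma a * (b * Gamma b))) = y / (a * b) by field_simp,
      show Gamma p * Gamma q * (y / (p * Gamma p * (q * Gamma q))) = y / (p * q) by field_simp]
    exact div_lt_div_of_pos_left hy (by positivity) h0

lemma modLommel_eq_gammaSeries (μ ν : ℝ) {x : ℝ} (hx : 0 < x) :
    modLommel μ ν x =
      (x / 2) ^ (μ + 1) * gammaSeries ((μ - ν + 3) / 2) ((μ + ν + 3) / 2) ((x / 2) ^ 2) := by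
  unfold modLommel gammaSeries
  rw [← tsum_mul_left]
  refine tsum_congr fun k => ?_
  rw [mul_div_assoc', ← pow_mul, ← rpow_natCast (x / 2) (2 * k), ← rpow_add (by positivity)]
  congr 2
  push_cast
  ring

lemma modStruve_eq_gammaSeries (ν : ℝ) {x : ℝ} (hx : 0 < x) :
    modStruve ν x = (x / 2) ^ (ν + 1) * gammaSeries (3 / 2) (ν + 3 / 2) ((x / 2) ^ 2) := by
  unfold modStruve gammaSeries
  rw [← tsum_mul_left]
  refine tsum_congr fun k => ?_
  rw [mul_div_assoc', ← pow_mul, ← rpow_natCast (x / 2) (2 * k), ← rpow_add (by positivity),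
    add_assoc (k : ℝ) ν (3 / 2)]
  congr 2
  push_cast
  ring

lemma Gamma_three_half : Gamma (3 / 2) = √π / 2 := by
  rw [show (3 / 2 : ℝ) = 1 / 2 + 1 by norm_num, Real.Gamma_add_one (by norm_num),
    Gamma_one_half_eq]
  ring

lemma struve_bound_eq_gammaSeries (μ ν G : ℝ) {x : ℝ} (hx : 0 < x) :
    √π * (2 : ℝ) ^ (ν - μ - 1) * Gamma (ν + 3 / 2) / G * (x ^ (μ - ν) * modStruve ν x) =
      (x / 2) ^ (μ + 1) / G *
        (Gamma (3 / 2) * Gamma (ν + 3 / 2) *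
          gammaSeries (3 / 2) (ν + 3 / 2) ((x / 2) ^ 2)) := by
  have hpow : (2 : ℝ) ^ (ν - μ - 1) * x ^ (μ - ν) * (x / 2) ^ (ν + 1) =
      (x / 2) ^ (μ + 1) / 2 := by
    rw [show μ + 1 = (μ - ν) + (ν + 1) by ring, rpow_add (by positivity : 0 < x / 2) (μ - ν),
      div_rpow hx.le two_pos.le (μ - ν), show ν - μ - 1 = -(μ - ν) - 1 by ring,
      rpow_sub_one two_ne_zero, rpow_neg two_pos.le]
    ring
  rw [modStruve_eq_gammaSeries ν hx, Gamma_three_half]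
  linear_combination √π * Gamma (ν + 3 / 2) / G *
    gammaSeries (3 / 2) (ν + 3 / 2) ((x / 2) ^ 2) * hpow

lemma modLommel_eq_div_mul {μ ν x : ℝ} (ha : 0 < (μ - ν + 3) / 2) (hb : 0 < (μ + ν + 3) / 2)
    (hx : 0 < x) :
    modLommel μ ν x =
      (x / 2) ^ (μ + 1) / (Gamma ((μ - ν + 3) / 2) * Gamma ((μ + ν + 3) / 2)) *
        (Gamma ((μ - ν + 3) / 2) * Gamma ((μ + ν + 3) / 2) *
          gammaSeries ((μ - ν + 3) / 2) ((μ + ν + 3) / 2) ((x / 2) ^ 2)) := by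
  have hGa := (Gamma_pos_of_pos ha).ne'
  have hGb := (Gamma_pos_of_pos hb).ne'
  rw [modLommel_eq_gammaSeries μ ν hx]
  field_simp

theorem stmt_6 (μ ν : ℝ) :
    (-3/2 < ν → ν < μ → ∀ x : ℝ, 0 < x →
      modLommel μ ν x <
        Real.sqrt π * (2 : ℝ) ^ (ν - μ - 1) * Gamma (ν + 3/2) /
          (Gamma ((μ - ν + 3) / 2) * Gamma ((μ + ν + 3) / 2)) *
          (x ^ (μ - ν) * modStruve ν x)) ∧
    (((-3 < μ ∧ μ ≤ -3/2 ∧ |ν| < μ + 3) ∨ (-3/2 < μ ∧ μ < ν ∧ ν < μ + 3)) →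
      ∀ x : ℝ, 0 < x →
      modLommel μ ν x >
        Real.sqrt π * (2 : ℝ) ^ (ν - μ - 1) * Gamma (ν + 3/2) /
          (Gamma ((μ - ν + 3) / 2) * Gamma ((μ + ν + 3) / 2)) *
          (x ^ (μ - ν) * modStruve ν x)) := by
  have hdiff (j : ℕ) : ((j : ℝ) + (μ - ν + 3) / 2) * (j + (μ + ν + 3) / 2) -
      (j + 3 / 2) * (j + (ν + 3 / 2)) = (μ - ν) * (j + (μ + ν + 6) / 4) := by ring
  have hcoef {x : ℝ} (ha : 0 < (μ - ν + 3) / 2) (hb : 0 < (μ + ν + 3) / 2) (hx : 0 < x) :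
      0 < (x / 2) ^ (μ + 1) / (Gamma ((μ - ν + 3) / 2) * Gamma ((μ + ν + 3) / 2)) := by
    have := Gamma_pos_of_pos ha
    have := Gamma_pos_of_pos hb
    positivity
  constructor
  · intro hν hνμ x hx
    have ha : 0 < (μ - ν + 3) / 2 := by linarith
    have hb : 0 < (μ + ν + 3) / 2 := by linarith
    rw [struve_bound_eq_gammaSeries μ ν _ hx, modLommel_eq_div_mul ha hb hx]
    refine mul_lt_mul_of_pos_left
      (gammaSeries_lt ha hb (by norm_num) (by linarith) (by positivity) fun j => ?_)
      (hcoef ha hb hx)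
    have hj : (0 : ℝ) ≤ j := j.cast_nonneg
    have := mul_pos (sub_pos.2 hνμ) (by linarith : 0 < (j : ℝ) + (μ + ν + 6) / 4)
    linarith [hdiff j]
  · intro h x hx
    obtain ⟨hμν, hν, hνμ, hsum⟩ : μ < ν ∧ -3 / 2 < ν ∧ ν < μ + 3 ∧ 0 < μ + ν + 3 := by
      rcases h with ⟨h₁, h₂, h₃⟩ | ⟨h₁, h₂, h₃⟩
      · obtain ⟨h₄, h₅⟩ := abs_lt.1 h₃
        exact ⟨by linarith, by linarith, h₅, by linarith⟩
      · exact ⟨h₂, by linarith, h₃, by linarith⟩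
    have ha : 0 < (μ - ν + 3) / 2 := by linarith
    have hb : 0 < (μ + ν + 3) / 2 := by linarith
    rw [struve_bound_eq_gammaSeries μ ν _ hx, modLommel_eq_div_mul ha hb hx]
    refine mul_lt_mul_of_pos_left
      (gammaSeries_lt (by norm_num) (by linarith) ha hb (by positivity) fun j => ?_)
      (hcoef ha hb hx)
    have hj : (0 : ℝ) ≤ j := j.cast_nonneg
    have := mul_pos (sub_pos.2 hμν) (by linarith : 0 < (j : ℝ) + (μ + ν + 6) / 4)
    linarith [hdiff j]
end

section
/- Let μ, ν be real with μ > −2 and |ν| < |μ+1|. Then for all x > 0, t̃_{μ,ν}(x) < (Γ(μ+2) / (Γ((μ−ν+3)/2) Γ((μ+ν+3)/2))) · I_{μ+1}(x). The inequality is reversed (with strict >) for all x > 0 if μ > −2 and |μ+1| < |ν| < μ+3. -/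
open Real

/-- Modified Bessel function of the first kind. -/
noncomputable def modBessel (ν x : ℝ) : ℝ :=
  ∑' k : ℕ, (x / 2) ^ (2 * (k : ℝ) + ν) /
    ((Nat.factorial k : ℝ) * Gamma ((k : ℝ) + ν + 1))

open Filter Topology

/-- The series `∑ y ^ (p + 2k) / (Γ(k + a) Γ(k + b))` converges for `a, b, y > 0`. -/
lemma summable_rpow_div_Gamma_mul_Gamma {a b y : ℝ} (p : ℝ) (ha : 0 < a) (hb : 0 < b)
    (hy : 0 < y) :
    Summable fun k : ℕ => y ^ (p + 2 * (k : ℝ)) / (Gamma (k + a) * Gamma (k + b)) := by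
  have hpos (k : ℕ) : 0 < y ^ (p + 2 * (k : ℝ)) / (Gamma (k + a) * Gamma (k + b)) := by
    have := Gamma_pos_of_pos (show 0 < (k : ℝ) + a by positivity)
    have := Gamma_pos_of_pos (show 0 < (k : ℝ) + b by positivity)
    positivity
  refine summable_of_ratio_test_tendsto_lt_one zero_lt_one
    (Eventually.of_forall fun k => (hpos k).ne') ?_
  have hlim : Tendsto (fun k : ℕ => y ^ 2 / (((k : ℝ) + a) * (k + b))) atTop (𝓝 0) := by
    refine tendsto_const_nhds.div_atTop (Tendsto.atTop_mul_atTop₀ ?_ ?_)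
    · exact tendsto_atTop_add_const_right _ _ tendsto_natCast_atTop_atTop
    · exact tendsto_atTop_add_const_right _ _ tendsto_natCast_atTop_atTop
  refine hlim.congr fun k => ?_
  have hka : 0 < (k : ℝ) + a := by positivity
  have hkb : 0 < (k : ℝ) + b := by positivity
  have hGa := Gamma_pos_of_pos hka
  have hGb := Gamma_pos_of_pos hkb
  rw [norm_of_nonneg (hpos _).le, norm_of_nonneg (hpos _).le]
  push_cast
  rw [show (k : ℝ) + 1 + a = k + a + 1 by ring, show (k : ℝ) + 1 + b = k + b + 1 by ring,
    Gamma_add_one hka.ne', Gamma_add_one hkb.ne',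
    show p + 2 * ((k : ℝ) + 1) = p + 2 * k + (2 : ℕ) by push_cast; ring,
    rpow_add hy, rpow_natCast]
  have := rpow_pos_of_pos hy (p + 2 * (k : ℝ))
  field_simp

/-- Comparison of products of Pochhammer symbols with equal sum of parameters, written with Gamma
functions. -/
lemma Gamma_mul_Gamma_natCast_add_le {a b c d : ℝ} (ha : 0 < a) (hb : 0 < b) (hc : 0 < c)
    (hd : 0 < d) (hsum : a + b = c + d) (hprod : c * d ≤ a * b) (k : ℕ) :
    Gamma a * Gamma b * (Gamma (k + c) * Gamma (k + d)) ≤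
      Gamma c * Gamma d * (Gamma (k + a) * Gamma (k + b)) := by
  induction k with
  | zero => simp [mul_comm]
  | succ k ih =>
    have hka : 0 < (k : ℝ) + a := by positivity
    have hkb : 0 < (k : ℝ) + b := by positivity
    have hkc : 0 < (k : ℝ) + c := by positivity
    have hkd : 0 < (k : ℝ) + d := by positivity
    have hshift (t : ℝ) : ((k + 1 : ℕ) : ℝ) + t = k + t + 1 := by push_cast; ring
    simp only [hshift]
    rw [Gamma_add_one hka.ne', Gamma_add_one hkb.ne', Gamma_add_one hkc.ne',
      Gamma_add_one hkd.ne']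
    have hfac : ((k : ℝ) + c) * (k + d) ≤ (k + a) * (k + b) := by
      linear_combination hprod - (k : ℝ) * hsum
    have := Gamma_pos_of_pos hc
    have := Gamma_pos_of_pos hd
    have := Gamma_pos_of_pos hka
    have := Gamma_pos_of_pos hkb
    calc _ = (((k : ℝ) + c) * (k + d)) *
          (Gamma a * Gamma b * (Gamma (k + c) * Gamma (k + d))) := by ring
      _ ≤ (((k : ℝ) + a) * (k + b)) *
          (Gamma c * Gamma d * (Gamma (k + a) * Gamma (k + b))) := by gcongr
      _ = _ := by ring

lemma Gamma_mul_tsum_lt {a b c d y : ℝ} (p : ℝ) (ha : 0 < a) (hb : 0 < b) (hc : 0 < c)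
    (hd : 0 < d) (hy : 0 < y) (hsum : a + b = c + d) (hprod : c * d < a * b) :
    Gamma a * Gamma b * ∑' k : ℕ, y ^ (p + 2 * (k : ℝ)) / (Gamma (k + a) * Gamma (k + b)) <
      Gamma c * Gamma d *
        ∑' k : ℕ, y ^ (p + 2 * (k : ℝ)) / (Gamma (k + c) * Gamma (k + d)) := by
  have hGa := Gamma_pos_of_pos ha
  have hGb := Gamma_pos_of_pos hb
  have hGc := Gamma_pos_of_pos hc
  have hGd := Gamma_pos_of_pos hd
  rw [← tsum_mul_left, ← tsum_mul_left]
  refine Summable.tsum_lt_tsum (i := 1) (fun k => ?_) ?_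
    ((summable_rpow_div_Gamma_mul_Gamma p ha hb hy).mul_left _)
    ((summable_rpow_div_Gamma_mul_Gamma p hc hd hy).mul_left _)
  · have := Gamma_pos_of_pos (show 0 < (k : ℝ) + a by positivity)
    have := Gamma_pos_of_pos (show 0 < (k : ℝ) + b by positivity)
    have := Gamma_pos_of_pos (show 0 < (k : ℝ) + c by positivity)
    have := Gamma_pos_of_pos (show 0 < (k : ℝ) + d by positivity)
    rw [← mul_div_assoc, ← mul_div_assoc, div_le_div_iff₀ (by positivity) (by positivity)]
    have hk := mul_le_mul_of_nonneg_left
      (Gamma_mul_Gamma_natCast_add_le ha hb hc hd hsum hprod.le k)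
      (rpow_pos_of_pos hy (p + 2 * (k : ℝ))).le
    linear_combination hk
  · have hfirst {s t : ℝ} (hs : 0 < s) (ht : 0 < t) :
        Gamma s * Gamma t * (y ^ (p + 2 * ((1 : ℕ) : ℝ)) /
          (Gamma ((1 : ℕ) + s) * Gamma ((1 : ℕ) + t))) =
        y ^ (p + 2 * ((1 : ℕ) : ℝ)) / (s * t) := by
      have := Gamma_pos_of_pos hs
      have := Gamma_pos_of_pos ht
      rw [Nat.cast_one, add_comm 1 s, add_comm 1 t, Gamma_add_one hs.ne', Gamma_add_one ht.ne']
      field_simp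
    rw [hfirst ha hb, hfirst hc hd]
    exact div_lt_div_of_pos_left (rpow_pos_of_pos hy _) (by positivity) hprod

theorem stmt_8 (μ ν : ℝ) (hμ : μ > -2) :
    (|ν| < |μ + 1| → ∀ x : ℝ, 0 < x →
      modLommel μ ν x <
        Gamma (μ + 2) / (Gamma ((μ - ν + 3) / 2) * Gamma ((μ + ν + 3) / 2)) *
          modBessel (μ + 1) x) ∧
    (|μ + 1| < |ν| → |ν| < μ + 3 → ∀ x : ℝ, 0 < x →
      modLommel μ ν x >
        Gamma (μ + 2) / (Gamma ((μ - ν + 3) / 2) * Gamma ((μ + ν + 3) / 2)) *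
          modBessel (μ + 1) x) := by
  have hLommel (x : ℝ) : modLommel μ ν x = ∑' k : ℕ, (x / 2) ^ (μ + 1 + 2 * (k : ℝ)) /
      (Gamma (k + (μ - ν + 3) / 2) * Gamma (k + (μ + ν + 3) / 2)) := by
    unfold modLommel
    refine tsum_congr fun k => ?_
    rw [add_right_comm]
  have hBessel (x : ℝ) : modBessel (μ + 1) x = ∑' k : ℕ, (x / 2) ^ (μ + 1 + 2 * (k : ℝ)) /
      (Gamma (k + 1) * Gamma (k + (μ + 2))) := by
    unfold modBessel
    refine tsum_congr fun k => ?_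
    rw [Gamma_nat_eq_factorial, add_comm (2 * (k : ℝ)),
      show (k : ℝ) + (μ + 1) + 1 = k + (μ + 2) by ring]
  have hc : 0 < μ + 2 := by linarith
  have hsum : (μ - ν + 3) / 2 + (μ + ν + 3) / 2 = 1 + (μ + 2) := by ring
  constructor
  · intro h x hx
    have hν : |ν| < μ + 3 := h.trans (abs_lt.2 ⟨by linarith, by linarith⟩)
    obtain ⟨hν₁, hν₂⟩ := abs_lt.1 hν
    have ha : 0 < (μ - ν + 3) / 2 := by linarith
    have hb : 0 < (μ + ν + 3) / 2 := by linarith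
    have hprod : 1 * (μ + 2) < (μ - ν + 3) / 2 * ((μ + ν + 3) / 2) := by
      linear_combination (sq_lt_sq.2 h) / 4
    have key := Gamma_mul_tsum_lt (μ + 1) ha hb one_pos hc (half_pos hx) hsum hprod
    rw [← hLommel, ← hBessel, Gamma_one, one_mul] at key
    have := Gamma_pos_of_pos ha
    have := Gamma_pos_of_pos hb
    rwa [div_mul_eq_mul_div, lt_div_iff₀' (by positivity)]
  · intro h hν x hx
    obtain ⟨hν₁, hν₂⟩ := abs_lt.1 hν
    have ha : 0 < (μ - ν + 3) / 2 := by linarith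
    have hb : 0 < (μ + ν + 3) / 2 := by linarith
    have hprod : (μ - ν + 3) / 2 * ((μ + ν + 3) / 2) < 1 * (μ + 2) := by
      linear_combination (sq_lt_sq.2 h) / 4
    have key := Gamma_mul_tsum_lt (μ + 1) one_pos hc ha hb (half_pos hx) hsum.symm hprod
    rw [← hLommel, ← hBessel, Gamma_one, one_mul] at key
    have := Gamma_pos_of_pos ha
    have := Gamma_pos_of_pos hb
    rwa [gt_iff_lt, div_mul_eq_mul_div, div_lt_iff₀' (by positivity)]
end

section
/- Let μ, ν be real with μ > −1 and 1/2 ≤ ν < μ+1, and let Δ_{μ,ν}(x) = (t̃_{μ,ν}(x))² − t̃_{μ−1,ν−1}(x) t̃_{μ+1,ν+1}(x). Then for all x > 0, Δ_{μ,ν}(x) < (μ−ν+4)(t̃_{μ,ν}(x))² / (μ + 3/2 + √((ν+3/2)² + x²)). -/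
open Real

/-- Power series coefficient of the entire part of the modified Lommel function. -/
noncomputable def lommelCoeff (a b : ℝ) (k : ℕ) : ℝ :=
  (Gamma ((k : ℝ) + a) * Gamma ((k : ℝ) + b))⁻¹

/-- Entire part of the modified Lommel function, with
`a = (μ - ν + 3) / 2` and `b = (μ + ν + 3) / 2`. -/
noncomputable def lommelSeries (a b z : ℝ) : ℝ :=
  ∑' k : ℕ, lommelCoeff a b k * z ^ k

/-- Termwise derivative of `lommelSeries`. -/
noncomputable def lommelSeriesDeriv (a b z : ℝ) : ℝ :=
  ∑' k : ℕ, lommelCoeff a b k * ((k : ℝ) * z ^ (k - 1))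

lemma lommelCoeff_pos {a b : ℝ} (ha : 0 < a) (hb : 0 < b) (k : ℕ) : 0 < lommelCoeff a b k := by
  unfold lommelCoeff
  have h1 := Gamma_pos_of_pos (show (0 : ℝ) < (k : ℝ) + a by positivity)
  have h2 := Gamma_pos_of_pos (show (0 : ℝ) < (k : ℝ) + b by positivity)
  positivity

lemma lommelCoeff_succ {a b : ℝ} (ha : 0 < a) (hb : 0 < b) (k : ℕ) :
    lommelCoeff a b (k + 1) = lommelCoeff a b k / (((k : ℝ) + a) * ((k : ℝ) + b)) := by
  unfold lommelCoeff
  have h1 : Gamma (((k + 1 : ℕ) : ℝ) + a) = ((k : ℝ) + a) * Gamma ((k : ℝ) + a) := by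
    rw [← Gamma_add_one (by positivity)]
    push_cast
    ring_nf
  have h2 : Gamma (((k + 1 : ℕ) : ℝ) + b) = ((k : ℝ) + b) * Gamma ((k : ℝ) + b) := by
    rw [← Gamma_add_one (by positivity)]
    push_cast
    ring_nf
  rw [h1, h2, div_eq_mul_inv, ← mul_inv]
  ring_nf

lemma lommelCoeff_sub_one {a b : ℝ} (hb : 1 < b) (k : ℕ) :
    lommelCoeff a (b - 1) k = ((k : ℝ) + (b - 1)) * lommelCoeff a b k := by
  unfold lommelCoeff
  have hpos : 0 < (k : ℝ) + (b - 1) := by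
    have : (0 : ℝ) ≤ k := k.cast_nonneg
    linarith
  have h2 : Gamma ((k : ℝ) + b) = ((k : ℝ) + (b - 1)) * Gamma ((k : ℝ) + (b - 1)) := by
    rw [← Gamma_add_one hpos.ne']
    ring_nf
  rw [h2, mul_inv, mul_inv, mul_inv]
  field_simp

lemma lommelCoeff_add_one {a b : ℝ} (ha : 0 < a) (k : ℕ) :
    lommelCoeff a (b + 1) k = ((k : ℝ) + a) * lommelCoeff a b (k + 1) := by
  unfold lommelCoeff
  have hpos : 0 < (k : ℝ) + a := by positivity
  have h1 : Gamma (((k + 1 : ℕ) : ℝ) + a) = ((k : ℝ) + a) * Gamma ((k : ℝ) + a) := by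
    rw [← Gamma_add_one hpos.ne']
    push_cast
    ring_nf
  have h2 : ((k + 1 : ℕ) : ℝ) + b = (k : ℝ) + (b + 1) := by
    push_cast
    ring
  rw [h1, h2, mul_inv, mul_inv, mul_inv]
  field_simp

lemma lommelCoeff_le {a b : ℝ} (ha : 1 ≤ a) (hb : 1 / 2 ≤ b) (k : ℕ) :
    lommelCoeff a b k ≤ lommelCoeff a b 0 * (2 ^ k / (k.factorial : ℝ)) := by
  induction k with
  | zero => simp
  | succ k ih =>
    have hk : (0 : ℝ) ≤ k := k.cast_nonneg
    have hfac : (0 : ℝ) < (k.factorial : ℝ) := by exact_mod_cast k.factorial_pos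
    have h0 := lommelCoeff_pos (show 0 < a by linarith) (show 0 < b by linarith) 0
    rw [lommelCoeff_succ (by linarith) (by linarith)]
    have hden : ((k : ℝ) + 1) / 2 ≤ ((k : ℝ) + a) * ((k : ℝ) + b) := by nlinarith
    calc lommelCoeff a b k / (((k : ℝ) + a) * ((k : ℝ) + b))
        ≤ lommelCoeff a b 0 * (2 ^ k / (k.factorial : ℝ)) / (((k : ℝ) + 1) / 2) := by
          gcongr
      _ = lommelCoeff a b 0 * (2 ^ (k + 1) / ((k + 1).factorial : ℝ)) := by
          rw [Nat.factorial_succ]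
          push_cast
          field_simp
          ring

lemma norm_lommelCoeff_mul_pow_le {a b r z : ℝ} (ha : 1 ≤ a) (hb : 1 / 2 ≤ b) (hr : 1 ≤ r)
    (hz : |z| ≤ r) (k : ℕ) :
    ‖lommelCoeff a b k * ((k : ℝ) * z ^ (k - 1))‖ ≤
      lommelCoeff a b 0 * ((4 * r) ^ k / (k.factorial : ℝ)) := by
  have h0 := lommelCoeff_pos (show 0 < a by linarith) (show 0 < b by linarith) 0
  have hk0 := lommelCoeff_pos (show 0 < a by linarith) (show 0 < b by linarith) k
  have hk : (k : ℝ) ≤ 2 ^ k := by exact_mod_cast Nat.lt_two_pow_self.le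
  have hpow : |z| ^ (k - 1) ≤ r ^ k :=
    (pow_le_pow_left₀ (abs_nonneg z) hz _).trans (pow_le_pow_right₀ hr (Nat.sub_le _ _))
  rw [norm_mul, norm_mul, norm_pow, Real.norm_eq_abs, Real.norm_eq_abs, Real.norm_eq_abs,
    abs_of_pos hk0, Nat.abs_cast]
  calc lommelCoeff a b k * ((k : ℝ) * |z| ^ (k - 1))
      ≤ lommelCoeff a b 0 * (2 ^ k / (k.factorial : ℝ)) * (2 ^ k * r ^ k) := by
        gcongr
        exact lommelCoeff_le ha hb k
    _ = lommelCoeff a b 0 * ((4 * r) ^ k / (k.factorial : ℝ)) := by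
        rw [show (4 : ℝ) * r = 2 * 2 * r by ring, mul_pow, mul_pow]
        ring

lemma summable_lommelCoeff_mul_pow {a b : ℝ} (ha : 1 ≤ a) (hb : 1 / 2 ≤ b) (z : ℝ) :
    Summable fun k : ℕ => lommelCoeff a b k * z ^ k := by
  have h0 := lommelCoeff_pos (show 0 < a by linarith) (show 0 < b by linarith) 0
  refine Summable.of_norm_bounded
    ((Real.summable_pow_div_factorial (2 * |z|)).mul_left (lommelCoeff a b 0)) fun k => ?_
  have hk0 := lommelCoeff_pos (show 0 < a by linarith) (show 0 < b by linarith) k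
  rw [norm_mul, norm_pow, Real.norm_eq_abs, Real.norm_eq_abs, abs_of_pos hk0]
  calc lommelCoeff a b k * |z| ^ k
      ≤ lommelCoeff a b 0 * (2 ^ k / (k.factorial : ℝ)) * |z| ^ k := by
        gcongr
        exact lommelCoeff_le ha hb k
    _ = lommelCoeff a b 0 * ((2 * |z|) ^ k / (k.factorial : ℝ)) := by
        rw [mul_pow]
        ring

lemma summable_lommelSeriesDeriv {a b : ℝ} (ha : 1 ≤ a) (hb : 1 / 2 ≤ b) (z : ℝ) :
    Summable fun k : ℕ => lommelCoeff a b k * ((k : ℝ) * z ^ (k - 1)) :=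
  Summable.of_norm_bounded
    ((Real.summable_pow_div_factorial (4 * (|z| + 1))).mul_left (lommelCoeff a b 0))
    (norm_lommelCoeff_mul_pow_le ha hb (by linarith [abs_nonneg z]) (by linarith))

lemma hasDerivAt_lommelSeries {a b : ℝ} (ha : 1 ≤ a) (hb : 1 / 2 ≤ b) (z : ℝ) :
    HasDerivAt (lommelSeries a b) (lommelSeriesDeriv a b z) z := by
  have hz : z ∈ Metric.ball (0 : ℝ) (|z| + 1) := by simp
  refine hasDerivAt_tsum_of_isPreconnected
    (g := fun (k : ℕ) (y : ℝ) => lommelCoeff a b k * y ^ k)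
    (g' := fun (k : ℕ) (y : ℝ) => lommelCoeff a b k * ((k : ℝ) * y ^ (k - 1)))
    ((Real.summable_pow_div_factorial (4 * (|z| + 1))).mul_left (lommelCoeff a b 0))
    Metric.isOpen_ball (convex_ball (0 : ℝ) (|z| + 1)).isPreconnected
    (fun k y _ => (hasDerivAt_pow k y).const_mul _) (fun k y hy => ?_) hz
    (summable_lommelCoeff_mul_pow ha hb z) hz
  have hy' : |y| < |z| + 1 := by simpa using hy
  exact norm_lommelCoeff_mul_pow_le ha hb (by linarith [abs_nonneg z]) hy'.le k

lemma mul_lommelSeriesDeriv {a b : ℝ} (ha : 1 ≤ a) (hb : 3 / 2 ≤ b) (z : ℝ) :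
    z * lommelSeriesDeriv a b z = lommelSeries a (b - 1) z - (b - 1) * lommelSeries a b z := by
  have h1 := (summable_lommelSeriesDeriv ha (show 1 / 2 ≤ b by linarith) z).hasSum.mul_left z
  have h2 := (summable_lommelCoeff_mul_pow ha (show 1 / 2 ≤ b by linarith) z).hasSum.mul_left
    (b - 1)
  have h3 : HasSum (fun k : ℕ => lommelCoeff a (b - 1) k * z ^ k) _ :=
    (h1.add h2).congr_fun fun k => by
      rw [lommelCoeff_sub_one (by linarith)]
      rcases k with _ | k
      · simp
      · simp only [Nat.add_sub_cancel, pow_succ]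
        ring
  have := h3.tsum_eq
  unfold lommelSeries lommelSeriesDeriv
  linarith

lemma mul_lommelSeriesDeriv' {a b : ℝ} (ha : 1 ≤ a) (hb : 1 / 2 ≤ b) (z : ℝ) :
    z * lommelSeriesDeriv a b z = z * lommelSeries a (b + 1) z -
      (a - 1) * (lommelSeries a b z - lommelCoeff a b 0) := by
  have hs := summable_lommelCoeff_mul_pow ha hb z
  have h1 := (summable_lommelSeriesDeriv ha hb z).hasSum.mul_left z
  have h2 := hs.hasSum.mul_left (a - 1)
  have h3 := (h1.add h2).tsum_eq
  rw [((h1.add h2).summable).tsum_eq_zero_add] at h3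
  have h4 : ∀ k : ℕ, z * (lommelCoeff a b (k + 1) * (((k + 1 : ℕ) : ℝ) * z ^ (k + 1 - 1))) +
      (a - 1) * (lommelCoeff a b (k + 1) * z ^ (k + 1)) =
        z * (lommelCoeff a (b + 1) k * z ^ k) := fun k => by
    rw [lommelCoeff_add_one (by linarith)]
    simp only [Nat.add_sub_cancel, pow_succ]
    push_cast
    ring
  simp only [h4, tsum_mul_left] at h3
  simp only [Nat.cast_zero, zero_mul, mul_zero, zero_add, pow_zero, mul_one] at h3
  unfold lommelSeries lommelSeriesDeriv
  linarith

lemma lommelCoeff_zero_le_lommelSeries {a b z : ℝ} (ha : 1 ≤ a) (hb : 1 / 2 ≤ b) (hz : 0 ≤ z) :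
    lommelCoeff a b 0 ≤ lommelSeries a b z := by
  have h := (summable_lommelCoeff_mul_pow ha hb z).le_tsum 0 fun k _ =>
    mul_nonneg (lommelCoeff_pos (show 0 < a by linarith) (show 0 < b by linarith) k).le
      (pow_nonneg hz k)
  simpa [lommelSeries] using h

lemma lommelSeries_pos {a b z : ℝ} (ha : 1 ≤ a) (hb : 1 / 2 ≤ b) (hz : 0 ≤ z) :
    0 < lommelSeries a b z :=
  (lommelCoeff_pos (by linarith) (by linarith) 0).trans_le
    (lommelCoeff_zero_le_lommelSeries ha hb hz)

lemma lommelSeriesDeriv_nonneg {a b z : ℝ} (ha : 1 ≤ a) (hb : 1 / 2 ≤ b) (hz : 0 ≤ z) :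
    0 ≤ lommelSeriesDeriv a b z :=
  tsum_nonneg fun k =>
    mul_nonneg (lommelCoeff_pos (show 0 < a by linarith) (show 0 < b by linarith) k).le
      (by positivity)

lemma hasDerivAt_lommelSeries_sq {a b : ℝ} (ha : 1 ≤ a) (hb : 1 / 2 ≤ b) (x : ℝ) :
    HasDerivAt (fun x => lommelSeries a b ((x / 2) ^ 2))
      (lommelSeriesDeriv a b ((x / 2) ^ 2) * (x / 2)) x := by
  have h : HasDerivAt (fun x : ℝ => (x / 2) ^ 2) (x / 2) x := by
    refine (((hasDerivAt_id x).div_const 2).pow 2).congr_deriv ?_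
    simp only [id]
    ring
  exact (hasDerivAt_lommelSeries ha hb ((x / 2) ^ 2)).comp x h

lemma modLommel_eq_lommelSeries {μ ν x : ℝ} (hx : 0 < x) :
    modLommel μ ν x = (x / 2) ^ (μ + 1) *
      lommelSeries ((μ - ν + 3) / 2) ((μ + ν + 3) / 2) ((x / 2) ^ 2) := by
  unfold modLommel lommelSeries lommelCoeff
  rw [← tsum_mul_left]
  refine tsum_congr fun k => ?_
  have h : (x / 2) ^ (μ + 2 * (k : ℝ) + 1) = (x / 2) ^ (μ + 1) * ((x / 2) ^ 2) ^ k := by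
    rw [show μ + 2 * (k : ℝ) + 1 = μ + 1 + ((2 * k : ℕ) : ℝ) by push_cast; ring,
      rpow_add_natCast (by positivity), pow_mul]
  rw [h, div_eq_mul_inv]
  ring

/-- A function on `(0, ∞)` that increases wherever it is negative and is not negative in the
limit at `0` is nonnegative. -/
lemma nonneg_of_deriv_pos_of_neg {w w' : ℝ → ℝ} (hw : ∀ x, 0 < x → HasDerivAt w (w' x) x)
    (hmono : ∀ x, 0 < x → w x < 0 → 0 < w' x) (hlim : ∀ x, 0 < x → x < 1 → -x ≤ w x)
    {x : ℝ} (hx : 0 < x) : 0 ≤ w x := by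
  by_contra! hneg
  obtain ⟨ε, hε0, hε1, hεx, hεw⟩ : ∃ ε, 0 < ε ∧ ε < 1 ∧ ε < x ∧ w x < -ε := by
    refine ⟨min (min (1 / 2) (x / 2)) (-w x / 2), ?_, ?_, ?_, ?_⟩
    · have : 0 < -w x := by linarith
      positivity
    · have := (min_le_left (min (1 / 2) (x / 2)) (-w x / 2)).trans (min_le_left _ _)
      linarith
    · have := (min_le_left (min (1 / 2) (x / 2)) (-w x / 2)).trans (min_le_right _ _)
      linarith
    · have := min_le_right (min (1 / 2) (x / 2)) (-w x / 2)
      linarith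
  have hεle := hlim ε hε0 hε1
  have hderiv : ∀ s, s < 0 → HasDerivAt (fun s => w (-s)) (-w' (-s)) s := fun s hs => by
    have := (hw (-s) (by linarith)).comp s (hasDerivAt_neg s)
    simpa [Function.comp_def] using this
  have hbound : ∀ ⦃s⦄, s ∈ Set.Icc (-x) (-ε) → w (-s) ≤ w x := by
    refine image_le_of_deriv_right_lt_deriv_boundary (f := fun s => w (-s))
      (f' := fun s => -w' (-s)) (B := fun _ => w x) (B' := fun _ => 0) ?_ ?_ ?_ ?_ ?_
    · exact fun s hs => (hderiv s (by linarith [hs.2])).continuousAt.continuousWithinAt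
    · exact fun s hs => (hderiv s (by linarith [hs.2])).hasDerivWithinAt
    · simp
    · exact fun s => hasDerivAt_const s (w x)
    · intro s hs hsw
      have := hmono (-s) (by linarith [hs.2]) (by simpa only [hsw] using hneg)
      linarith
  have := hbound (show -ε ∈ Set.Icc (-x) (-ε) from ⟨by linarith, le_rfl⟩)
  rw [neg_neg] at this
  linarith

lemma hasDerivAt_sqrt_sq_add_sq (c : ℝ) {x : ℝ} (hx : 0 < x) :
    HasDerivAt (fun x => √(c ^ 2 + x ^ 2)) (x / √(c ^ 2 + x ^ 2)) x := by
  refine (((hasDerivAt_pow 2 x).const_add (c ^ 2)).sqrt (by positivity)).congr_deriv ?_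
  simp only [Nat.cast_ofNat, Nat.add_one_sub_one, pow_one]
  field_simp

/-- Lower bound for the ratio of consecutive series, lowering the second parameter. -/
lemma add_sqrt_le_lommelSeries_ratio {a b x : ℝ} (ha : 1 < a) (hab : 1 / 2 ≤ b - a)
    (hx : 0 < x) :
    (b - a - 1 / 2 + √((b - a - 1 / 2) ^ 2 + x ^ 2)) / x ≤
      2 * lommelSeries a (b - 1) ((x / 2) ^ 2) / (x * lommelSeries a b ((x / 2) ^ 2)) := by
  obtain ⟨n, hn⟩ : ∃ n, n = b - a - 1 / 2 := ⟨_, rfl⟩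
  rw [← hn, ← sub_nonneg]
  refine nonneg_of_deriv_pos_of_neg
    (w := fun x => 2 * lommelSeries a (b - 1) ((x / 2) ^ 2) /
      (x * lommelSeries a b ((x / 2) ^ 2)) - (n + √(n ^ 2 + x ^ 2)) / x)
    (fun x hx => ((((hasDerivAt_lommelSeries_sq ha.le (by linarith) x).const_mul 2).div
      ((hasDerivAt_id x).mul (hasDerivAt_lommelSeries_sq ha.le (by linarith) x))
      (mul_pos hx (lommelSeries_pos ha.le (by linarith) (by positivity))).ne').sub
      (((hasDerivAt_sqrt_sq_add_sq n hx).const_add n).div (hasDerivAt_id x) hx.ne')))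
    ?_ ?_ hx
  · intro x hx hneg
    have hz : (0 : ℝ) ≤ (x / 2) ^ 2 := by positivity
    have hA := lommelSeries_pos ha.le (show 1 / 2 ≤ b - 1 by linarith) hz
    have hB := lommelSeries_pos ha.le (show 1 / 2 ≤ b by linarith) hz
    have hc := lommelCoeff_pos (show 0 < a by linarith) (show 0 < b - 1 by linarith) 0
    have hA' := mul_lommelSeriesDeriv' ha.le (show 1 / 2 ≤ b - 1 by linarith) ((x / 2) ^ 2)
    have hB' := mul_lommelSeriesDeriv ha.le (show 3 / 2 ≤ b by linarith) ((x / 2) ^ 2)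
    rw [sub_add_cancel] at hA'
    simp only [Pi.mul_apply, id_eq, one_mul, mul_one]
    generalize lommelSeries a (b - 1) ((x / 2) ^ 2) = A at *
    generalize lommelSeries a b ((x / 2) ^ 2) = B at *
    generalize lommelSeriesDeriv a (b - 1) ((x / 2) ^ 2) = A' at *
    generalize lommelSeriesDeriv a b ((x / 2) ^ 2) = B' at *
    generalize lommelCoeff a (b - 1) 0 = c at *
    have hs2 : √(n ^ 2 + x ^ 2) ^ 2 = n ^ 2 + x ^ 2 := Real.sq_sqrt (by positivity)
    have hs0 : 0 < √(n ^ 2 + x ^ 2) := Real.sqrt_pos.2 (by positivity)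
    generalize √(n ^ 2 + x ^ 2) = s at *
    have hn0 : 0 ≤ n := by linarith
    have hns : n < s := by nlinarith
    have hlow : (x / s * x - (n + s)) / x ^ 2 ≤ 0 := by
      refine div_nonpos_of_nonpos_of_nonneg ?_ (by positivity)
      rw [sub_nonpos, div_mul_eq_mul_div, div_le_iff₀ hs0]
      nlinarith
    have hY : 2 * A < (n + s) * B := by
      rw [sub_neg, div_lt_div_iff₀ (by positivity) hx] at hneg
      nlinarith
    have hquad : 0 < x ^ 2 * B ^ 2 + 2 * n * (2 * A) * B - (2 * A) ^ 2 := by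
      have h1 : 0 < (n + s) * B - 2 * A := by linarith
      have h2 : 0 < (s - n) * B + 2 * A := by
        have : 0 < (s - n) * B := mul_pos (by linarith) hB
        linarith
      nlinarith [mul_pos h1 h2]
    have hup : 0 < (2 * (A' * (x / 2)) * (x * B) - 2 * A * (B + x * (B' * (x / 2)))) /
        (x * B) ^ 2 := by
      refine div_pos ?_ (by positivity)
      have : 2 * (A' * (x / 2)) * (x * B) - 2 * A * (B + x * (B' * (x / 2))) =
          x ^ 2 * B ^ 2 + 2 * n * (2 * A) * B - (2 * A) ^ 2 + 4 * (a - 1) * c * B := by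
        linear_combination 4 * B * hA' - 4 * A * hB' - 4 * A * B * hn
      rw [this]
      have : 0 < (a - 1) * c * B := mul_pos (mul_pos (by linarith) hc) hB
      linarith
    linarith
  · intro x hx hx1
    have hz : (0 : ℝ) ≤ (x / 2) ^ 2 := by positivity
    have hB := lommelSeries_pos ha.le (show 1 / 2 ≤ b by linarith) hz
    have hB' := mul_lommelSeriesDeriv ha.le (show 3 / 2 ≤ b by linarith) ((x / 2) ^ 2)
    have hBn := mul_nonneg hz (lommelSeriesDeriv_nonneg ha.le (show 1 / 2 ≤ b by linarith) hz)
    have hs : √(n ^ 2 + x ^ 2) ≤ n + x := by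
      refine Real.sqrt_le_iff.2 ⟨by linarith, by nlinarith⟩
    have : (n + √(n ^ 2 + x ^ 2)) / x ≤ 2 * lommelSeries a (b - 1) ((x / 2) ^ 2) /
        (x * lommelSeries a b ((x / 2) ^ 2)) := by
      rw [← div_div, div_right_comm]
      gcongr
      rw [le_div_iff₀ hB]
      calc (n + √(n ^ 2 + x ^ 2)) * lommelSeries a b ((x / 2) ^ 2)
          ≤ (2 * (b - 1)) * lommelSeries a b ((x / 2) ^ 2) := by gcongr; linarith
        _ ≤ _ := by linarith
    linarith

/-- Lower bound for the ratio of consecutive series, raising the second parameter. -/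
lemma div_add_sqrt_le_lommelSeries_ratio {a b x : ℝ} (ha : 1 < a) (hb : 1 / 2 ≤ b)
    (hx : 0 < x) :
    x / (b - 1 / 2 + √((b + 1 / 2) ^ 2 + x ^ 2)) ≤
      x * lommelSeries a (b + 1) ((x / 2) ^ 2) / (2 * lommelSeries a b ((x / 2) ^ 2)) := by
  have hD : ∀ x : ℝ, 0 < x → 0 < b - 1 / 2 + √((b + 1 / 2) ^ 2 + x ^ 2) := fun x hx => by
    have : 0 < √((b + 1 / 2) ^ 2 + x ^ 2) := Real.sqrt_pos.2 (by positivity)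
    linarith
  rw [← sub_nonneg]
  refine nonneg_of_deriv_pos_of_neg
    (w := fun x => x * lommelSeries a (b + 1) ((x / 2) ^ 2) /
      (2 * lommelSeries a b ((x / 2) ^ 2)) - x / (b - 1 / 2 + √((b + 1 / 2) ^ 2 + x ^ 2)))
    (fun x hx => ((((hasDerivAt_id x).mul
      (hasDerivAt_lommelSeries_sq ha.le (by linarith) x)).div
      ((hasDerivAt_lommelSeries_sq ha.le (by linarith) x).const_mul 2)
      (mul_pos two_pos (lommelSeries_pos ha.le (by linarith) (by positivity))).ne').sub
      ((hasDerivAt_id x).div ((hasDerivAt_sqrt_sq_add_sq (b + 1 / 2) hx).const_add (b - 1 / 2))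
        (hD x hx).ne')))
    ?_ ?_ hx
  · intro x hx hneg
    have hz : (0 : ℝ) ≤ (x / 2) ^ 2 := by positivity
    have hDx := hD x hx
    have hC := lommelSeries_pos ha.le (show 1 / 2 ≤ b + 1 by linarith) hz
    have hB := lommelSeries_pos ha.le hb hz
    have hc := lommelCoeff_zero_le_lommelSeries ha.le hb hz
    have hC' := mul_lommelSeriesDeriv ha.le (show 3 / 2 ≤ b + 1 by linarith) ((x / 2) ^ 2)
    have hB' := mul_lommelSeriesDeriv' ha.le hb ((x / 2) ^ 2)
    rw [add_sub_cancel_right] at hC'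
    simp only [Pi.mul_apply, id_eq, one_mul]
    generalize lommelSeries a (b + 1) ((x / 2) ^ 2) = C at *
    generalize lommelSeries a b ((x / 2) ^ 2) = B at *
    generalize lommelSeriesDeriv a (b + 1) ((x / 2) ^ 2) = C' at *
    generalize lommelSeriesDeriv a b ((x / 2) ^ 2) = B' at *
    generalize lommelCoeff a b 0 = c at *
    have hs2 : √((b + 1 / 2) ^ 2 + x ^ 2) ^ 2 = (b + 1 / 2) ^ 2 + x ^ 2 :=
      Real.sq_sqrt (by positivity)
    have hs0 : 0 < √((b + 1 / 2) ^ 2 + x ^ 2) := Real.sqrt_pos.2 (by positivity)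
    generalize √((b + 1 / 2) ^ 2 + x ^ 2) = s at *
    have hbs : b + 1 / 2 < s := by nlinarith
    obtain ⟨D, hDdef⟩ : ∃ D, D = b - 1 / 2 + s := ⟨_, rfl⟩
    rw [← hDdef] at hDx hneg ⊢
    have hup : (D - x * (x / s)) / D ^ 2 ≤ 2 * b / D ^ 2 := by
      gcongr
      have : x * (x / s) = s - (b + 1 / 2) ^ 2 / s := by
        field_simp
        linarith
      have : (b + 1 / 2) ^ 2 / s ≤ b + 1 / 2 := by
        rw [div_le_iff₀ hs0]
        nlinarith
      linarith
    have hq : C * D < 2 * B := by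
      rw [sub_neg, div_lt_div_iff₀ (by positivity) hDx] at hneg
      nlinarith
    have hlow : 2 * b / D ^ 2 <
        ((C + x * (C' * (x / 2))) * (2 * B) - x * C * (2 * (B' * (x / 2)))) / (2 * B) ^ 2 := by
      rw [div_lt_div_iff₀ (by positivity) (by positivity)]
      have hnum : (C + x * (C' * (x / 2))) * (2 * B) - x * C * (2 * (B' * (x / 2))) =
          4 * B ^ 2 - (4 * b - 2) * B * C - x ^ 2 * C ^ 2 + 4 * (a - 1) * C * (B - c) := by
        linear_combination 4 * B * hC' - 4 * C * hB'
      have hpos : 0 ≤ 4 * (a - 1) * C * (B - c) * D ^ 2 := by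
        have h1 : 0 ≤ a - 1 := by linarith
        have h2 : 0 ≤ B - c := by linarith
        positivity
      have hlin : (4 * b - 2) * B * D * (C * D) ≤ (4 * b - 2) * B * D * (2 * B) := by
        have : 0 ≤ 4 * b - 2 := by linarith
        gcongr
      have hsq : x ^ 2 * (C * D) ^ 2 < x ^ 2 * (2 * B) ^ 2 := by
        gcongr
      have hDsq : D ^ 2 = (2 * b - 1) * D + x ^ 2 + 2 * b := by
        rw [hDdef]
        linear_combination hs2
      have hBD : B ^ 2 * D ^ 2 = B ^ 2 * ((2 * b - 1) * D + x ^ 2 + 2 * b) := by rw [hDsq]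
      rw [hnum]
      linarith
    linarith
  · intro x hx hx1
    have hz : (0 : ℝ) ≤ (x / 2) ^ 2 := by positivity
    have hC := lommelSeries_pos ha.le (show 1 / 2 ≤ b + 1 by linarith) hz
    have hB := lommelSeries_pos ha.le hb hz
    have h1 : 0 ≤ x * lommelSeries a (b + 1) ((x / 2) ^ 2) /
        (2 * lommelSeries a b ((x / 2) ^ 2)) := by positivity
    have h2 : x / (b - 1 / 2 + √((b + 1 / 2) ^ 2 + x ^ 2)) ≤ x := by
      refine div_le_self hx.le ?_
      have : b + 1 / 2 ≤ √((b + 1 / 2) ^ 2 + x ^ 2) := Real.le_sqrt_of_sq_le (by nlinarith)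
      linarith
    linarith

lemma sqrt_sq_add_sq_lt {u v x : ℝ} (huv : u < v) (hx : 0 < x) :
    √(v ^ 2 + x ^ 2) < √(u ^ 2 + x ^ 2) + (v - u) := by
  have hs2 : √(u ^ 2 + x ^ 2) ^ 2 = u ^ 2 + x ^ 2 := Real.sq_sqrt (by positivity)
  have hs0 : 0 < √(u ^ 2 + x ^ 2) := Real.sqrt_pos.2 (by positivity)
  have hus : u < √(u ^ 2 + x ^ 2) := Real.lt_sqrt_of_sq_lt (by nlinarith)
  refine (Real.sqrt_lt' (by linarith)).2 ?_
  nlinarith [mul_pos (sub_pos.2 huv) (sub_pos.2 hus)]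

theorem stmt_16 (μ ν : ℝ) (hμ : μ > -1) (hν₀ : 1/2 ≤ ν) (hν₁ : ν < μ + 1) :
    ∀ x : ℝ, 0 < x →
      (modLommel μ ν x) ^ 2 - modLommel (μ - 1) (ν - 1) x * modLommel (μ + 1) (ν + 1) x <
        (μ - ν + 4) * (modLommel μ ν x) ^ 2 /
          (μ + 3/2 + Real.sqrt ((ν + 3/2) ^ 2 + x ^ 2)) := by
  intro x hx
  obtain ⟨a, ha⟩ : ∃ a, a = (μ - ν + 3) / 2 := ⟨_, rfl⟩
  obtain ⟨b, hb⟩ : ∃ b, b = (μ + ν + 3) / 2 := ⟨_, rfl⟩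
  have ha1 : 1 < a := by linarith
  have hz : (0 : ℝ) ≤ (x / 2) ^ 2 := by positivity
  have hB := lommelSeries_pos ha1.le (show 1 / 2 ≤ b by linarith) hz
  have hlow := add_sqrt_le_lommelSeries_ratio ha1 (show 1 / 2 ≤ b - a by linarith) hx
  have hraise := div_add_sqrt_le_lommelSeries_ratio ha1 (show 1 / 2 ≤ b by linarith) hx
  have hsqrt := sqrt_sq_add_sq_lt (show ν + 3 / 2 < b + 1 / 2 by linarith) hx
  have hsqrt' := sqrt_sq_add_sq_lt (show ν - 1 / 2 < ν + 3 / 2 by linarith) hx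
  rw [show b - a - 1 / 2 = ν - 1 / 2 by linarith] at hlow
  rw [modLommel_eq_lommelSeries hx, modLommel_eq_lommelSeries hx, modLommel_eq_lommelSeries hx,
    show (μ - 1 - (ν - 1) + 3) / 2 = a by linarith,
    show (μ - 1 + (ν - 1) + 3) / 2 = b - 1 by linarith,
    show (μ + 1 - (ν + 1) + 3) / 2 = a by linarith,
    show (μ + 1 + (ν + 1) + 3) / 2 = b + 1 by linarith, ← ha, ← hb]
  have hpow : (x / 2) ^ (μ - 1 + 1) * (x / 2) ^ (μ + 1 + 1) = ((x / 2) ^ (μ + 1)) ^ 2 := by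
    rw [← rpow_add (by positivity), ← rpow_natCast, ← rpow_mul (by positivity)]
    congr 1
    push_cast
    ring
  have hP : 0 < (x / 2) ^ (μ + 1) := rpow_pos_of_pos (by positivity) _
  have hS : 0 < √((ν + 3 / 2) ^ 2 + x ^ 2) := Real.sqrt_pos.2 (by positivity)
  have hs : 0 < √((ν - 1 / 2) ^ 2 + x ^ 2) := Real.sqrt_pos.2 (by positivity)
  have hR : 0 < √((b + 1 / 2) ^ 2 + x ^ 2) := Real.sqrt_pos.2 (by positivity)
  generalize lommelSeries a (b - 1) ((x / 2) ^ 2) = A at *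
  generalize lommelSeries a b ((x / 2) ^ 2) = B at *
  generalize lommelSeries a (b + 1) ((x / 2) ^ 2) = C at *
  generalize √((ν + 3 / 2) ^ 2 + x ^ 2) = S at *
  generalize √((ν - 1 / 2) ^ 2 + x ^ 2) = s at *
  generalize √((b + 1 / 2) ^ 2 + x ^ 2) = R at *
  have hraise' : x / (μ + 3 / 2 + S) ≤ x * C / (2 * B) :=
    (div_le_div_of_nonneg_left hx.le (by linarith) (by linarith)).trans hraise
  have hlow0 : 0 ≤ (ν - 1 / 2 + s) / x := div_nonneg (by linarith) hx.le
  have hD : 0 < μ + 3 / 2 + S := by linarith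
  have hprod := mul_le_mul hlow hraise' (by positivity) (hlow0.trans hlow)
  have hprod' : (ν - 1 / 2 + s) / (μ + 3 / 2 + S) ≤ A * C / B ^ 2 := by
    calc (ν - 1 / 2 + s) / (μ + 3 / 2 + S) = (ν - 1 / 2 + s) / x * (x / (μ + 3 / 2 + S)) := by
          field_simp
      _ ≤ _ := hprod
      _ = A * C / B ^ 2 := by field_simp
  rw [div_le_div_iff₀ hD (by positivity)] at hprod'
  have hmain : (B ^ 2 - A * C) * (μ + 3 / 2 + S) < (μ - ν + 4) * B ^ 2 := by
    have : 0 < (2 + s - S) * B ^ 2 := mul_pos (by linarith) (by positivity)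
    linarith
  rw [lt_div_iff₀ hD]
  calc _ = ((x / 2) ^ (μ + 1)) ^ 2 * ((B ^ 2 - A * C) * (μ + 3 / 2 + S)) := by
        linear_combination (-(A * C) * (μ + 3 / 2 + S)) * hpow
    _ < ((x / 2) ^ (μ + 1)) ^ 2 * ((μ - ν + 4) * B ^ 2) := by gcongr
    _ = _ := by ring
end
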